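/- For any cyclic group G of order n and positive integers m ≤ n and h, there exists a symmetric subset R of G (i.e., R = -R) with |R| ≥ m such that |hR| ≤ (h⌈m/d⌉ - h + 1)·d for some divisor d of n achieving the minimum of this expression; consequently ρ_±(G, m, h) ≤ ρ(G, m, h). Since trivially hA ⊆ h_±A gives ρ(G,m,h) ≤ ρ_±(G,m,h), in fact ρ_±(G, m, h) = ρ(G, m, h). -/

import Mathlib

open Finset Pointwise

/-- `h`-fold sumset of a finite set. -/
def hsum {G : Type*} [AddCommMonoid G] [DecidableEq G] : ℕ → Finset G → Finset G
  | 0, _ => {0}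
  | n + 1, A => A + hsum n A

/-- `h`-fold signed sumset of a finite set: all sums `∑ λ_g • g` with integer coefficients
supported on `A` satisfying `∑ |λ_g| = h`. -/
def signedSumset {G : Type*} [AddCommGroup G] [DecidableEq G] (h : ℕ) (A : Finset G) :
    Set G :=
  {x | ∃ c : G → ℤ, (∀ g, c g ≠ 0 → g ∈ A) ∧ (∑ g ∈ A, (c g).natAbs) = h ∧
    x = ∑ g ∈ A, c g • g}

/-- Mann's theorem, with a subgroup that depends only on `S`: if `S` is not the whole group, there
is a subgroup `H` such that every `X` with `X + S` not the whole group satisfies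
`|X + S| ≥ |X| + |H + S| - |H|`. -/
theorem exists_addSubgroup_card_add_le {G : Type*} [AddCommGroup G] [Fintype G] [DecidableEq G]
    (S : Finset G) (hS : S.Nonempty) (hSu : S ≠ univ) :
    ∃ (H : AddSubgroup G) (F : Finset G), (∀ g, g ∈ F ↔ g ∈ H) ∧ F + S ≠ univ ∧
      ∀ X : Finset G, X.Nonempty → X + S ≠ univ → #X + #(F + S) ≤ #(X + S) + #F := by
  obtain ⟨X₀, hX₀, hmin₀⟩ := exists_min_image
    (univ.filter fun X : Finset G => X.Nonempty ∧ X + S ≠ univ) (fun X => #(X + S) - #X)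
    ⟨{0}, by simpa [singleton_add] using hSu⟩
  obtain ⟨F, hF, hmin⟩ := exists_min_image
    (univ.filter fun X : Finset G => (X.Nonempty ∧ X + S ≠ univ) ∧
      #(X + S) - #X = #(X₀ + S) - #X₀) (fun X => #X) ⟨X₀, by simpa using hX₀⟩
  simp only [mem_filter, mem_univ, true_and] at hX₀ hmin₀ hF hmin
  obtain ⟨⟨hFne, hFS⟩, hFκ⟩ := hF
  have hle (X : Finset G) : #X ≤ #(X + S) := card_le_card_add_right hS
  have hκ (X : Finset G) (h1 : X.Nonempty) (h2 : X + S ≠ univ) :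
      #X + #(F + S) ≤ #(X + S) + #F := by
    have := hmin₀ X ⟨h1, h2⟩
    have := hle X
    have := hle F
    omega
  have hatom (X : Finset G) (h1 : X.Nonempty) (h2 : X + S ≠ univ)
      (h3 : #(X + S) + #F ≤ #X + #(F + S)) : #F ≤ #X := by
    have := hmin₀ X ⟨h1, h2⟩
    have := hle X
    have := hle F
    exact hmin X ⟨⟨h1, h2⟩, by omega⟩
  have hcompl : 2 * #F + (#(F + S) - #F) ≤ Fintype.card G := by
    have hc : #(-(F + S)ᶜ) = Fintype.card G - #(F + S) := by rw [card_neg, card_compl]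
    have hsub : -(F + S)ᶜ + S ⊆ (-F)ᶜ := by
      intro z hz
      obtain ⟨u, hu, s, hs, rfl⟩ := mem_add.1 hz
      rw [mem_neg'] at hu
      rw [mem_compl] at hu ⊢
      intro hz
      rw [mem_neg'] at hz
      exact hu (mem_add.2 ⟨_, hz, s, hs, by abel⟩)
    have hcard := card_le_card hsub
    rw [card_compl, card_neg] at hcard
    have h1 : (-(F + S)ᶜ).Nonempty := by
      rw [neg_nonempty_iff, nonempty_iff_ne_empty, Ne, compl_eq_empty_iff]
      exact hFS
    have h2 : -(F + S)ᶜ + S ≠ univ := by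
      intro h
      rw [h, univ_subset_iff, compl_eq_univ_iff] at hsub
      simp [hFne.ne_empty] at hsub
    have := card_le_univ F
    have := card_le_univ (F + S)
    have := hle F
    have := hatom _ h1 h2 (by omega)
    omega
  have htrans (g : G) (hg : (F ∩ (g +ᵥ F)).Nonempty) : g +ᵥ F = F := by
    have e1 : #((g +ᵥ F) + S) = #(F + S) := by rw [vadd_add_assoc, card_vadd_finset]
    have e2 : #(g +ᵥ F) = #F := card_vadd_finset _ _
    have hi : F ∩ (g +ᵥ F) + S ⊆ (F + S) ∩ ((g +ᵥ F) + S) := inter_add_subset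
    have hu : (F ∪ (g +ᵥ F)) + S = (F + S) ∪ ((g +ᵥ F) + S) := union_add
    have c1 := card_union_add_card_inter (F + S) ((g +ᵥ F) + S)
    have c2 := card_union_add_card_inter F (g +ᵥ F)
    have c3 := card_le_card hi
    rw [← hu] at c1
    have hine : F ∩ (g +ᵥ F) + S ≠ univ := fun h => hFS <| by
      rw [h, univ_subset_iff] at hi
      rw [← univ_subset_iff, ← hi]
      exact inter_subset_left
    have k1 := hκ _ hg hine
    have hpos := hg.card_pos
    have := hle F
    have hune : (F ∪ (g +ᵥ F)) + S ≠ univ := by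
      intro h
      rw [h, card_univ] at c1
      omega
    have k2 := hκ _ (hFne.mono subset_union_left) hune
    have k3 := hatom _ hg hine (by omega)
    have : F ∩ (g +ᵥ F) = F := eq_of_subset_of_card_le inter_subset_left k3
    exact (eq_of_subset_of_card_le (inter_eq_left.1 this) e2.le).symm
  obtain ⟨f, hf⟩ := hFne
  refine ⟨AddAction.stabilizer G F, -f +ᵥ F, fun g => ?_, ?_, fun X h1 h2 => ?_⟩
  · rw [AddAction.mem_stabilizer_iff, mem_neg_vadd_finset_iff, vadd_eq_add]
    refine ⟨fun h => htrans g ⟨f + g, mem_inter.2 ⟨h, ?_⟩⟩, fun h => ?_⟩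
    · rw [add_comm]; exact vadd_mem_vadd_finset hf
    · rw [add_comm, ← h]; exact vadd_mem_vadd_finset hf
  · rw [vadd_add_assoc, Ne, vadd_finset_eq_univ]
    exact hFS
  · rw [vadd_add_assoc, card_vadd_finset, card_vadd_finset]
    exact hκ X h1 h2

theorem hsum_one {G : Type*} [AddCommMonoid G] [DecidableEq G] (A : Finset G) :
    hsum 1 A = A :=
  add_zero A

theorem hsum_nonempty {G : Type*} [AddCommMonoid G] [DecidableEq G] {A : Finset G}
    (hA : A.Nonempty) (h : ℕ) : (hsum h A).Nonempty := by
  induction h with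
  | zero => simp [hsum]
  | succ h ih => exact hA.add ih

theorem hsum_mono {G : Type*} [AddCommMonoid G] [DecidableEq G] {A B : Finset G}
    (hAB : A ⊆ B) (h : ℕ) : hsum h A ⊆ hsum h B := by
  induction h with
  | zero => simp [hsum]
  | succ h ih => exact add_subset_add hAB ih

theorem nsmul_mem_hsum {G : Type*} [AddCommMonoid G] [DecidableEq G] {A : Finset G} {a : G}
    (ha : a ∈ A) (h : ℕ) : h • a ∈ hsum h A := by
  induction h with
  | zero => simp [hsum]
  | succ h ih => rw [succ_nsmul']; exact add_mem_add ha ih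

theorem hsum_image {G K : Type*} [AddCommMonoid G] [DecidableEq G] [AddCommMonoid K]
    [DecidableEq K] (φ : K →+ G) (B : Finset K) (h : ℕ) :
    hsum h (B.image φ) = (hsum h B).image φ := by
  induction h with
  | zero => simp [hsum]
  | succ h ih => rw [hsum, hsum, ih, image_add]

theorem hsum_vadd {G : Type*} [AddCommGroup G] [DecidableEq G] (a : G) (B : Finset G) (h : ℕ) :
    hsum h (a +ᵥ B) = h • a +ᵥ hsum h B := by
  induction h with
  | zero => simp [hsum]
  | succ h ih => rw [hsum, hsum, ih, vadd_add_vadd_comm, succ_nsmul']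

theorem hsum_ne_univ {G : Type*} [AddCommGroup G] [Fintype G] [DecidableEq G] {A : Finset G}
    (hA : A.Nonempty) {j h : ℕ} (hjh : j ≤ h) (hh : hsum h A ≠ univ) : hsum j A ≠ univ := by
  induction hjh with
  | refl => exact hh
  | step _ ih =>
    obtain ⟨a, ha⟩ := hA
    refine ih fun h' => hh <| eq_univ_of_forall fun z => ?_
    rw [← add_sub_cancel a z, hsum, h']
    exact add_mem_add ha (mem_univ _)

/-- The bound `(h⌈m/d⌉ - h + 1)d` is at most `(hp + 1)d` as soon as `⌈m/d⌉ ≤ p + 1`. -/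
theorem kneserBound_le {h m d p : ℕ} (hd : 0 < d) (hp : m ≤ (p + 1) * d) :
    (h * ((m + d - 1) / d) - h + 1) * d ≤ (h * p + 1) * d := by
  have hc : (m + d - 1) / d ≤ p + 1 := by
    rw [← Nat.lt_succ_iff, Nat.div_lt_iff_lt_mul hd, Nat.succ_mul]
    omega
  have := Nat.mul_le_mul_left h hc
  rw [Nat.mul_succ] at this
  exact Nat.mul_le_mul_right d (by omega)

theorem kneserBound_eq {h m d : ℕ} (hd : 0 < d) (hm : 0 < m) :
    ∃ p, (h * ((m + d - 1) / d) - h + 1) * d = (h * p + 1) * d ∧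
      m ≤ (p + 1) * d ∧ p * d < m := by
  have hc : 1 ≤ (m + d - 1) / d := by
    rw [Nat.le_div_iff_mul_le hd]; omega
  obtain ⟨p, hp⟩ := Nat.exists_eq_add_of_le' hc
  refine ⟨p, by rw [hp, Nat.mul_succ, Nat.add_sub_cancel], ?_⟩
  have := Nat.div_mul_le_self (m + d - 1) d
  have := Nat.lt_div_mul_add hd (a := m + d - 1)
  rw [hp] at *
  rw [Nat.succ_mul] at *
  omega

theorem mem_vadd_iff_sub_mem {G : Type*} [AddCommGroup G] [DecidableEq G]
    {F : Finset G} {H : AddSubgroup G} (hF : ∀ g, g ∈ F ↔ g ∈ H) {x z : G} :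
    z ∈ x +ᵥ F ↔ z - x ∈ H := by
  rw [← hF, mem_vadd_finset]
  constructor
  · rintro ⟨f, hf, rfl⟩
    simpa using hf
  · exact fun h => ⟨_, h, by simp⟩

theorem lt_card_inter_add_card_inter {G : Type*} [AddCommGroup G] [DecidableEq G]
    {A F : Finset G} {H : AddSubgroup G} (hF : ∀ g, g ∈ F ↔ g ∈ H)
    (hcard : #(A + F) < #A + #F) {x x' : G} (hx : x ∈ A) (hx' : x' ∈ A) (hxx : x' - x ∉ H) :
    #F < #(A ∩ (x +ᵥ F)) + #(A ∩ (x' +ᵥ F)) := by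
  have hdisj : Disjoint (x +ᵥ F) (x' +ᵥ F) := by
    rw [disjoint_left]
    intro z hz hz'
    rw [mem_vadd_iff_sub_mem hF] at hz hz'
    refine hxx ?_
    convert H.sub_mem hz hz' using 1
    abel
  have hsub : (x +ᵥ F) ∪ (x' +ᵥ F) ⊆ A + F :=
    union_subset (vadd_finset_subset_add hx) (vadd_finset_subset_add hx')
  have hA : A ⊆ (A ∩ (x +ᵥ F)) ∪ (A ∩ (x' +ᵥ F)) ∪ ((A + F) \ ((x +ᵥ F) ∪ (x' +ᵥ F))) := by
    intro a ha
    have : a ∈ A + F := by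
      rw [← add_zero a]
      exact add_mem_add ha ((hF _).2 H.zero_mem)
    simp only [mem_union, mem_inter, mem_sdiff, ha, this, true_and]
    tauto
  have c1 := (card_le_card hA).trans
    ((card_union_le _ _).trans (Nat.add_le_add_right (card_union_le _ _) _))
  have c2 := card_sdiff_add_card_eq_card hsub
  rw [card_union_of_disjoint hdisj, card_vadd_finset, card_vadd_finset] at c2
  omega

/-- If `A` nearly fills the cosets of `H` it meets, then a sum of elements of `A` lies in a full
coset of `H` inside the sumset, unless all the summands lie in one sparsely filled coset. -/
theorem add_mem_hsum_or_sparse {G : Type*} [AddCommGroup G] [DecidableEq G]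
    {A F : Finset G} {H : AddSubgroup G} (hF : ∀ g, g ∈ F ↔ g ∈ H)
    (hcard : #(A + F) < #A + #F) {x y : G} (hx : x ∈ A) {j : ℕ} (hj : 1 ≤ j)
    (hy : y ∈ hsum j A) :
    (∀ t ∈ H, x + y + t ∈ hsum (j + 1) A) ∨
      (y - j • x ∈ H ∧ 2 * #(A ∩ (x +ᵥ F)) ≤ #F) := by
  have hpig (x x' : G) (hxx : #F < #(A ∩ (x +ᵥ F)) + #(A ∩ (x' +ᵥ F))) (t : G) (ht : t ∈ H) :
      ∃ a ∈ A, ∃ a' ∈ A, a + a' = x + x' + t := by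
    have hc : #((A ∩ (x' +ᵥ F)).image fun z => x + x' + t - z) = #(A ∩ (x' +ᵥ F)) :=
      card_image_of_injective _ sub_right_injective
    have h1 : (A ∩ (x' +ᵥ F)).image (fun z => x + x' + t - z) ⊆ x +ᵥ F := by
      intro w hw
      obtain ⟨z, hz, rfl⟩ := mem_image.1 hw
      rw [mem_vadd_iff_sub_mem hF]
      have := H.sub_mem ht ((mem_vadd_iff_sub_mem hF).1 (mem_inter.1 hz).2)
      convert this using 1
      abel
    have h2 := inter_nonempty_of_card_lt_card_add_card (inter_subset_right (s₁ := A)) h1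
      (by rw [hc, card_vadd_finset]; exact hxx)
    obtain ⟨a, ha⟩ := h2
    obtain ⟨ha, ha'⟩ := mem_inter.1 ha
    obtain ⟨z, hz, rfl⟩ := mem_image.1 ha'
    exact ⟨_, (mem_inter.1 ha).1, z, (mem_inter.1 hz).1, by abel⟩
  have hpair {x x' : G} (hx : x ∈ A) (hx' : x' ∈ A) :
      (∀ t ∈ H, ∃ a ∈ A, ∃ a' ∈ A, a + a' = x + x' + t) ∨
        (x' - x ∈ H ∧ 2 * #(A ∩ (x +ᵥ F)) ≤ #F) := by
    by_cases hc : #F < #(A ∩ (x +ᵥ F)) + #(A ∩ (x' +ᵥ F))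
    · exact .inl (hpig x x' hc)
    · have hxx : x' - x ∈ H := by_contra fun h => hc (lt_card_inter_add_card_inter hF hcard hx hx' h)
      have : x' +ᵥ F = x +ᵥ F := by
        ext z
        rw [mem_vadd_iff_sub_mem hF, mem_vadd_iff_sub_mem hF, ← H.add_mem_cancel_right hxx]
        congr! 1
        abel
      rw [this] at hc
      exact .inr ⟨hxx, by omega⟩
  induction j, hj using Nat.le_induction generalizing y with
  | base =>
    rw [hsum_one] at hy
    refine (hpair hx hy).imp (fun h t ht => ?_) (by simp)
    obtain ⟨a, ha, a', ha', e⟩ := h t ht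
    rw [hsum, hsum_one, ← e]
    exact add_mem_add ha ha'
  | succ j hj ih =>
    obtain ⟨x', hx', y', hy', rfl⟩ := mem_add.1 hy
    rcases ih hy' with h | ⟨h, -⟩
    · refine .inl fun t ht => ?_
      rw [show x + (x' + y') + t = x' + (x + y' + t) by abel]
      exact add_mem_add hx' (h t ht)
    rcases hpair hx hx' with h' | ⟨h', hs⟩
    · refine .inl fun t ht => ?_
      obtain ⟨a, ha, a', ha', e⟩ := h' t ht
      rw [show x + (x' + y') + t = a + (a' + y') by
        rw [← add_assoc a, e]; abel]
      exact add_mem_add ha (add_mem_add ha' hy')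
    · refine .inr ⟨?_, hs⟩
      convert H.add_mem h h' using 1
      rw [succ_nsmul]
      abel

/-- The lower bound in Plagne's theorem, for multiples of a single set. -/
theorem exists_dvd_kneserBound_le_card_hsum {G : Type*} [AddCommGroup G] [Fintype G]
    [DecidableEq G] {A : Finset G} (hA : A.Nonempty) {h : ℕ} (hh : 1 ≤ h) :
    ∃ d, d ∣ Fintype.card G ∧ (h * ((#A + d - 1) / d) - h + 1) * d ≤ #(hsum h A) := by
  classical
  induction hN : Fintype.card G using Nat.strong_induction_on generalizing G with
  | _ N IH =>
  subst hN
  have hA1 := hA.card_pos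
  by_cases hu : hsum h A = univ
  · refine ⟨Fintype.card G, dvd_rfl, ?_⟩
    rw [hu, card_univ]
    refine (kneserBound_le (p := 0) Fintype.card_pos ?_).trans (by simp)
    simpa using card_le_univ A
  have hAu : A ≠ univ := hsum_one A ▸ hsum_ne_univ hA hh hu
  obtain ⟨H, F, hF, hFA, hmann⟩ := exists_addSubgroup_card_add_le A hA hAu
  rw [add_comm F A] at hmann
  have h0F : (0 : G) ∈ F := (hF 0).2 H.zero_mem
  have hFpos : 0 < #F := card_pos.2 ⟨0, h0F⟩
  have hadd_univ : univ + A = univ := by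
    obtain ⟨a, ha⟩ := hA
    refine eq_univ_of_forall fun z => ?_
    rw [← sub_add_cancel z a]
    exact add_mem_add (mem_univ _) ha
  have hFu : F ≠ univ := fun h => hFA (by rw [h, hadd_univ])
  by_cases hcase : h = 1 ∨ #A + #F ≤ #(A + F) + 1
  · refine ⟨1, one_dvd _, (kneserBound_le (p := #A - 1) one_pos (by omega)).trans ?_⟩
    rw [mul_one]
    rcases hcase with rfl | hcase
    · rw [hsum_one]
      omega
    have key (j : ℕ) (hj : 1 ≤ j) (hu : hsum j A ≠ univ) : j * (#A - 1) + 1 ≤ #(hsum j A) := by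
      induction j, hj using Nat.le_induction with
      | base => rw [hsum_one]; omega
      | succ j hj ih =>
        have h1 := ih (hsum_ne_univ hA j.le_succ hu)
        rw [hsum, add_comm] at hu
        have h2 := hmann _ (hsum_nonempty hA j) hu
        rw [hsum, add_comm A, Nat.succ_mul]
        omega
    exact key h hh hu
  push Not at hcase
  obtain ⟨h1, hcase⟩ := hcase
  have hcard : #(A + F) < #A + #F := by omega
  obtain ⟨j, rfl⟩ : ∃ j, h = j + 1 := ⟨h - 1, by omega⟩
  have hj : 1 ≤ j := by omega
  have hdvd : #F ∣ #(A + F) := by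
    refine card_dvd_card_add_right ?_
    rintro _ ⟨x, -, rfl⟩ _ ⟨y, -, rfl⟩ hxy
    rw [Function.onFun, id, id, disjoint_left]
    intro z hz hz'
    refine hxy ?_
    change x +ᵥ F = y +ᵥ F
    have hz : z ∈ x +ᵥ F := hz
    have hz' : z ∈ y +ᵥ F := hz'
    rw [mem_vadd_iff_sub_mem hF] at hz hz'
    ext w
    rw [mem_vadd_iff_sub_mem hF, mem_vadd_iff_sub_mem hF, ← H.add_mem_cancel_right
      (H.sub_mem hz' hz)]
    congr! 1
    abel
  obtain ⟨q, hq⟩ : ∃ q, #(A + F) = (q + 1) * #F := by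
    obtain ⟨r, hr⟩ := hdvd
    have hpos := (hA.add ⟨0, h0F⟩).card_pos
    obtain ⟨q, rfl⟩ : ∃ q, r = q + 1 := Nat.exists_eq_succ_of_ne_zero <| by
      rintro rfl
      omega
    exact ⟨q, by rw [hr, mul_comm]⟩
  have hAF : A ⊆ A + F := subset_add_left A h0F
  have hperiodic (j : ℕ) (hj : 1 ≤ j) (hu : hsum j A + F ≠ univ) :
      (j * q + 1) * #F ≤ #(hsum j A + F) := by
    induction j, hj using Nat.le_induction with
    | base => rw [hsum_one, hq, one_mul]
    | succ j hj ih =>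
      have e : hsum (j + 1) A + F = hsum j A + F + A := by rw [hsum]; abel
      rw [e] at hu ⊢
      have h1 := ih fun h => hu (by rw [h, hadd_univ])
      have h2 := hmann _ ((hsum_nonempty hA j).add ⟨0, h0F⟩) hu
      rw [hq] at h2
      linarith
  have hdvdG : #F ∣ Fintype.card G := by
    have := H.card_addSubgroup_dvd_card
    rwa [Nat.card_eq_fintype_card, Nat.card_eq_fintype_card, Fintype.card_of_subtype F hF] at this
  by_cases hfull : hsum (j + 1) A + F ⊆ hsum (j + 1) A
  · refine ⟨#F, hdvdG, (kneserBound_le hFpos (hq ▸ card_le_card hAF)).trans ?_⟩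
    have e := hfull.antisymm (subset_add_left _ h0F)
    have := hperiodic (j + 1) hh (by rwa [e])
    rwa [e] at this
  obtain ⟨c', hc', hcn⟩ := not_subset.1 hfull
  obtain ⟨c, hc, t₀, ht₀, rfl⟩ := mem_add.1 hc'
  obtain ⟨a, ha, y, hy, rfl⟩ := mem_add.1 hc
  rw [hF] at ht₀
  obtain ⟨hya, hsparse⟩ := (add_mem_hsum_or_sparse hF hcard ha hj hy).resolve_left
    fun h => hcn (h _ ht₀)
  have hdich {x y : G} (hx : x ∈ A) (hy : y ∈ hsum j A) :
      (∀ t ∈ H, x + y + t ∈ hsum (j + 1) A) ∨ (y - j • x ∈ H ∧ x - a ∈ H) := by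
    refine (add_mem_hsum_or_sparse hF hcard hx hj hy).imp_right fun ⟨h1, h2⟩ => ⟨h1, ?_⟩
    by_contra h
    have := lt_card_inter_add_card_inter hF hcard ha hx h
    omega
  have hbound : ((j + 1) * q + 1) * #F ≤ #(hsum (j + 1) A + F) := by
    by_cases hu : hsum (j + 1) A + F = univ
    swap
    · exact hperiodic _ hh hu
    have hZ : #(((A + F) \ (a +ᵥ F)).image fun z => (j + 1) • a - z) = q * #F := by
      rw [card_image_of_injective _ sub_right_injective]
      have := card_sdiff_add_card_eq_card (vadd_finset_subset_add (t := F) ha)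
      rw [card_vadd_finset, hq] at this
      linarith
    have hdisj : Disjoint (hsum j A + F)
        (((A + F) \ (a +ᵥ F)).image fun z => (j + 1) • a - z) := by
      rw [disjoint_left]
      intro z hz hz'
      obtain ⟨t, ht, rfl⟩ := mem_image.1 hz'
      obtain ⟨ht, hta⟩ := mem_sdiff.1 ht
      obtain ⟨x, hx, f, hf, rfl⟩ := mem_add.1 ht
      obtain ⟨y', hy', f', hf', e⟩ := mem_add.1 hz
      rw [hF] at hf hf'
      rw [mem_vadd_iff_sub_mem hF] at hta
      rcases hdich hx hy' with h | ⟨-, h⟩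
      · refine hcn ?_
        convert h (f + f' + (y - j • a) + t₀)
          (H.add_mem (H.add_mem (H.add_mem hf hf') hya) ht₀) using 1
        rw [eq_sub_iff_add_eq, succ_nsmul] at e
        rw [show x + y' + (f + f' + (y - j • a) + t₀) =
          y' + f' + (x + f) + (y - j • a) + t₀ by abel, e]
        abel
      · refine hta ?_
        convert H.add_mem h hf using 1
        abel
    have hle := card_le_univ (hsum j A + F ∪ ((A + F) \ (a +ᵥ F)).image fun z => (j + 1) • a - z)
    rw [card_union_of_disjoint hdisj, hZ] at hle
    rw [hu, card_univ]
    by_cases hY : hsum j A + F = univ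
    · rw [hY, card_univ] at hle
      have hq0 : q * #F = 0 := by omega
      rw [add_mul, mul_assoc, hq0, mul_zero, zero_add, one_mul]
      exact card_le_univ F
    · have := hperiodic j hj hY
      linarith
  set B : Finset H := univ.filter fun b => a + (b : G) ∈ A with hB
  have hBA : a +ᵥ B.image H.subtype = A ∩ (a +ᵥ F) := by
    ext z
    rw [mem_inter, mem_vadd_iff_sub_mem hF, mem_vadd_finset]
    constructor
    · rintro ⟨_, hb, rfl⟩
      obtain ⟨b, hb, rfl⟩ := mem_image.1 hb
      simpa [hB] using hb
    · rintro ⟨hz, hza⟩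
      exact ⟨z - a, mem_image.2 ⟨⟨z - a, hza⟩, by simpa [hB] using hz, rfl⟩, by simp⟩
  have hBne : B.Nonempty := ⟨0, by simpa [hB] using ha⟩
  have hBcard : #B = #(A ∩ (a +ᵥ F)) := by
    rw [← hBA, card_vadd_finset, card_image_of_injective _ H.subtype_injective]
  have hHcard : Fintype.card H = #F := Fintype.card_of_subtype F hF
  obtain ⟨e, he, hle⟩ := IH (Fintype.card H)
    (by rw [hHcard]; exact (card_lt_iff_ne_univ F).2 hFu) hBne rfl
  have hsumB : hsum (j + 1) (A ∩ (a +ᵥ F)) =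
      (j + 1) • a +ᵥ (hsum (j + 1) B).image H.subtype := by
    rw [← hBA, hsum_vadd, hsum_image]
  have hsumBcard : #(hsum (j + 1) (A ∩ (a +ᵥ F))) = #(hsum (j + 1) B) := by
    rw [hsumB, card_vadd_finset, card_image_of_injective _ H.subtype_injective]
  have hsumBsub : hsum (j + 1) (A ∩ (a +ᵥ F)) ⊆ (j + 1) • a +ᵥ F := by
    rw [hsumB, vadd_finset_subset_vadd_finset_iff]
    intro z hz
    obtain ⟨b, -, rfl⟩ := mem_image.1 hz
    exact (hF _).2 b.2
  have hrest : (hsum (j + 1) A + F) \ ((j + 1) • a +ᵥ F) ⊆ hsum (j + 1) A := by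
    intro z hz
    obtain ⟨hz, hza⟩ := mem_sdiff.1 hz
    obtain ⟨w, hw, f, hf, rfl⟩ := mem_add.1 hz
    obtain ⟨x, hx, y', hy', rfl⟩ := mem_add.1 hw
    rw [mem_vadd_iff_sub_mem hF] at hza
    rw [hF] at hf
    rcases hdich hx hy' with h | ⟨h1, h2⟩
    · exact h f hf
    · refine absurd ?_ hza
      convert H.add_mem (H.add_mem h1 (H.nsmul_mem h2 (j + 1))) hf using 1
      simp only [nsmul_sub, succ_nsmul]
      abel
  have hc1 := card_le_card (union_subset hrest (hsum_mono (inter_subset_left (s₂ := a +ᵥ F)) (j + 1)))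
  rw [card_union_of_disjoint (disjoint_of_subset_right hsumBsub disjoint_sdiff_self_left),
    hsumBcard] at hc1
  have hc2 := le_card_sdiff ((j + 1) • a +ᵥ F) (hsum (j + 1) A + F)
  rw [card_vadd_finset] at hc2
  have hc3 : #A ≤ #B + q * #F := by
    have hsub : A ⊆ A ∩ (a +ᵥ F) ∪ (A + F) \ (a +ᵥ F) := by
      intro x hx
      simp only [mem_union, mem_inter, mem_sdiff, hx, hAF hx, true_and]
      exact em _
    have h1 := (card_le_card hsub).trans (card_union_le _ _)
    have h2 := card_sdiff_add_card_eq_card (vadd_finset_subset_add (t := F) ha)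
    rw [card_vadd_finset, hq] at h2
    rw [hBcard]
    linarith
  rw [hHcard] at he
  have hepos : 0 < e := Nat.pos_of_dvd_of_pos he hFpos
  obtain ⟨p, hp, hBp, -⟩ := kneserBound_eq (h := j + 1) hepos hBne.card_pos
  rw [hp] at hle
  obtain ⟨r, hr⟩ := he
  refine ⟨e, (Dvd.intro r hr.symm).trans hdvdG,
    (kneserBound_le (p := p + q * r) hepos ?_).trans ?_⟩
  · rw [hr] at hc3
    linarith
  · have : ((j + 1) * q + 1) * #F = (j + 1) * q * (e * r) + #F := by rw [add_mul, one_mul, ← hr]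
    have : ((j + 1) * (p + q * r) + 1) * e = (j + 1) * q * (e * r) + ((j + 1) * p + 1) * e := by
      ring
    omega

theorem add_mem_hsum {G : Type*} [AddCommMonoid G] [DecidableEq G] {A : Finset G} {i j : ℕ}
    {x y : G} (hx : x ∈ hsum i A) (hy : y ∈ hsum j A) : x + y ∈ hsum (i + j) A := by
  induction i generalizing x with
  | zero =>
    rw [hsum, mem_singleton] at hx
    simpa [hx] using hy
  | succ i ih =>
    obtain ⟨a, ha, z, hz, rfl⟩ := mem_add.1 hx
    rw [add_assoc a, Nat.succ_add]
    exact add_mem_add ha (ih hz)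

theorem hsum_subset_signedSumset {G : Type*} [AddCommGroup G] [DecidableEq G] (h : ℕ)
    (A : Finset G) : (hsum h A : Set G) ⊆ signedSumset h A := by
  intro x hx
  obtain ⟨c, hcA, hc, rfl⟩ : ∃ c : G → ℕ, (∀ g, c g ≠ 0 → g ∈ A) ∧ ∑ g ∈ A, c g = h ∧
      x = ∑ g ∈ A, c g • g := by
    rw [mem_coe] at hx
    induction h generalizing x with
    | zero => exact ⟨0, by simp, by simp, by simpa [hsum] using hx⟩
    | succ h ih =>
      obtain ⟨a, ha, y, hy, rfl⟩ := mem_add.1 hx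
      obtain ⟨c, hcA, hc, rfl⟩ := ih hy
      refine ⟨c + Pi.single a 1, fun g hg => ?_, ?_, ?_⟩
      · by_cases hga : g = a
        · exact hga ▸ ha
        · exact hcA g (by simpa [Pi.single_apply, hga] using hg)
      · simp [sum_add_distrib, Pi.single_apply, hc, ha]
      · simp [add_smul, sum_add_distrib, Pi.single_apply, ha, ite_smul, add_comm]
  exact ⟨fun g => c g, fun g hg => hcA g (by simpa using hg), by simpa using hc, by simp⟩

theorem signedSumset_subset_hsum {G : Type*} [AddCommGroup G] [DecidableEq G] (h : ℕ)
    {A R : Finset G} (hAR : A ⊆ R) (hR : ∀ x ∈ R, -x ∈ R) :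
    signedSumset h A ⊆ (hsum h R : Set G) := by
  rintro _ ⟨c, -, rfl, rfl⟩
  rw [mem_coe]
  have hterm (k : ℤ) {g : G} (hg : g ∈ R) : k • g ∈ hsum k.natAbs R := by
    rcases Int.natAbs_eq k with hk | hk
    · rw [hk, natCast_zsmul, Int.natAbs_natCast]
      exact nsmul_mem_hsum hg _
    · rw [hk, neg_smul, natCast_zsmul, Int.natAbs_neg, Int.natAbs_natCast, ← smul_neg]
      exact nsmul_mem_hsum (hR g hg) _
  induction A using Finset.induction_on with
  | empty => simp [hsum]
  | insert a s ha ih =>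
    rw [sum_insert ha, sum_insert ha]
    exact add_mem_hsum (hterm _ (hAR (mem_insert_self a s)))
      (ih ((subset_insert a s).trans hAR))

/-- The union of the cosets `c + i * s + N * ZMod (N * d)`, for `i < k`. -/
def cosetProgression (N d : ℕ) (s c : ℤ) (k : ℕ) : Finset (ZMod (N * d)) :=
  (range k ×ˢ range d).image fun p => ((c + p.1 * s + N * p.2 : ℤ) : ZMod (N * d))

theorem mem_cosetProgression {N d : ℕ} (hd : 0 < d) {s c : ℤ} {k : ℕ} {x : ZMod (N * d)} :
    x ∈ cosetProgression N d s c k ↔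
      ∃ i < k, ∃ t : ℤ, x = ((c + i * s + N * t : ℤ) : ZMod (N * d)) := by
  simp only [cosetProgression, mem_image, mem_product, mem_range, Prod.exists]
  constructor
  · rintro ⟨i, t, ⟨hi, -⟩, rfl⟩
    exact ⟨i, hi, t, rfl⟩
  · rintro ⟨i, hi, t, rfl⟩
    have hd' : (d : ℤ) ≠ 0 := by exact_mod_cast hd.ne'
    obtain ⟨r, hr⟩ := Int.eq_ofNat_of_zero_le (Int.emod_nonneg t hd')
    have hlt := Int.emod_lt_of_pos t (by exact_mod_cast hd : (0 : ℤ) < d)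
    refine ⟨i, r, ⟨hi, by omega⟩, ?_⟩
    rw [ZMod.intCast_eq_intCast_iff_dvd_sub]
    refine ⟨t / d, ?_⟩
    rw [← hr]
    push_cast
    linear_combination (N : ℤ) * (-Int.mul_ediv_add_emod t d)

theorem card_cosetProgression_le (N d : ℕ) (s c : ℤ) (k : ℕ) :
    #(cosetProgression N d s c k) ≤ k * d :=
  card_image_le.trans (by simp)

theorem card_cosetProgression {N d : ℕ} (hN : 0 < N) {s : ℤ} (hs : IsCoprime (N : ℤ) s) (c : ℤ)
    {k : ℕ} (hk : k ≤ N) : #(cosetProgression N d s c k) = k * d := by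
  rw [cosetProgression, card_image_of_injOn, card_product, card_range, card_range]
  rintro ⟨i, t⟩ hit ⟨i', t'⟩ hit' heq
  simp only [coe_product, Set.mem_prod, coe_range, Set.mem_Iio] at hit hit'
  simp only [ZMod.intCast_eq_intCast_iff_dvd_sub] at heq
  obtain ⟨u, hu⟩ := heq
  push_cast at hu
  have hi : (N : ℤ) ∣ (i' - i : ℤ) := by
    refine hs.dvd_of_dvd_mul_right ⟨d * u - (t' - t), ?_⟩
    linear_combination hu
  have hii : (i' - i : ℤ) = 0 := Int.eq_zero_of_abs_lt_dvd hi (by rw [abs_lt]; omega)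
  have ht : (d : ℤ) ∣ (t' - t : ℤ) := by
    refine ⟨u, mul_left_cancel₀ (by exact_mod_cast hN.ne' : (N : ℤ) ≠ 0) ?_⟩
    linear_combination hu - s * hii
  have htt : (t' - t : ℤ) = 0 := Int.eq_zero_of_abs_lt_dvd ht (by rw [abs_lt]; omega)
  ext <;> simp only <;> omega

theorem neg_mem_cosetProgression {N d : ℕ} (hd : 0 < d) {s c : ℤ} {k : ℕ}
    (hc : 2 * c = -(k * s)) {x : ZMod (N * d)} (hx : x ∈ cosetProgression N d s c (k + 1)) :
    -x ∈ cosetProgression N d s c (k + 1) := by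
  rw [mem_cosetProgression hd] at hx ⊢
  obtain ⟨i, hi, t, rfl⟩ := hx
  refine ⟨k - i, by omega, -t, ?_⟩
  rw [← Int.cast_neg]
  congr 1
  rw [Nat.cast_sub (by omega)]
  linear_combination -hc

theorem hsum_cosetProgression_subset {N d : ℕ} (hd : 0 < d) (s c : ℤ) (k h : ℕ) :
    hsum h (cosetProgression N d s c (k + 1)) ⊆
      cosetProgression N d s (h * c) (h * k + 1) := by
  induction h with
  | zero =>
    intro x hx
    rw [hsum, mem_singleton] at hx
    exact (mem_cosetProgression hd).2 ⟨0, by simp, 0, by simp [hx]⟩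
  | succ h ih =>
    intro x hx
    obtain ⟨a, ha, y, hy, rfl⟩ := mem_add.1 hx
    obtain ⟨i, hi, t, rfl⟩ := (mem_cosetProgression hd).1 ha
    obtain ⟨i', hi', t', rfl⟩ := (mem_cosetProgression hd).1 (ih hy)
    refine (mem_cosetProgression hd).2 ⟨i + i', by rw [Nat.succ_mul]; omega, t + t', ?_⟩
    push_cast
    ring

theorem exists_symmetric_card_hsum_le {n m h : ℕ} (hn : 0 < n) (hm : 1 ≤ m) (hmn : m ≤ n)
    (hh : 1 ≤ h) :
    ∃ R : Finset (ZMod n), (∀ x ∈ R, -x ∈ R) ∧ m ≤ R.card ∧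
      ∃ d : ℕ, d ∣ n ∧
        (hsum h R).card ≤ (h * ((m + d - 1) / d) - h + 1) * d ∧
        ∀ d' : ℕ, d' ∣ n →
          (h * ((m + d - 1) / d) - h + 1) * d ≤ (h * ((m + d' - 1) / d') - h + 1) * d' := by
  obtain ⟨d₀, hd₀, hmin₀⟩ := exists_min_image n.divisors
    (fun d => (h * ((m + d - 1) / d) - h + 1) * d) ⟨1, by simp [hn.ne']⟩
  obtain ⟨d, hd, hmax⟩ := exists_max_image (n.divisors.filter fun d =>
    (h * ((m + d - 1) / d) - h + 1) * d ≤ (h * ((m + d₀ - 1) / d₀) - h + 1) * d₀) id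
    ⟨d₀, by simpa using Nat.mem_divisors.1 hd₀⟩
  simp only [mem_filter, Nat.mem_divisors, id] at hd hmax hmin₀
  obtain ⟨⟨⟨N, hN⟩, -⟩, hd⟩ := hd
  rw [mul_comm] at hN
  subst hN
  have hdpos : 0 < d := Nat.pos_of_mul_pos_left hn
  have hNpos : 0 < N := Nat.pos_of_mul_pos_right hn
  obtain ⟨p, hp, hmp, hpm⟩ := kneserBound_eq (h := h) hdpos hm
  have hpN : p < N := Nat.lt_of_mul_lt_mul_right (hpm.trans_le hmn)
  obtain ⟨s, c, hs, hc⟩ : ∃ s c : ℤ, IsCoprime (N : ℤ) s ∧ 2 * c = -(p * s) := by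
    rcases Nat.even_or_odd' p with ⟨l, rfl | rfl⟩
    · exact ⟨1, -l, isCoprime_one_right, by push_cast; ring⟩
    rcases Nat.even_or_odd N with ⟨M, rfl⟩ | hNodd
    · have hle : (h * ((m + 2 * d - 1) / (2 * d)) - h + 1) * (2 * d) ≤
          (h * (2 * l + 1) + 1) * d := by
        refine (kneserBound_le (p := l) (by omega) (by linarith)).trans ?_
        nlinarith [Nat.mul_le_mul_right d hh]
      have := hmax (2 * d) ⟨⟨⟨M, by ring⟩, hn.ne'⟩, by rw [hp] at hd; exact hle.trans hd⟩
      omega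
    · refine ⟨2, -(2 * l + 1 : ℕ), ?_, by ring⟩
      exact_mod_cast Nat.isCoprime_iff_coprime.2 (Nat.coprime_two_right.2 hNodd)
  refine ⟨cosetProgression N d s c (p + 1), fun x => neg_mem_cosetProgression hdpos hc, ?_, d,
    Dvd.intro_left N rfl, ?_, fun d' hd' => hd.trans (hmin₀ d' ⟨hd', hn.ne'⟩)⟩
  · rwa [card_cosetProgression hNpos hs c hpN]
  · rw [hp]
    exact (card_le_card (hsum_cosetProgression_subset hdpos s c p h)).trans
      (card_cosetProgression_le ..)

/-- In a cyclic group there is a symmetric set `R` of size at least `m` whose `h`-fold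
sumset has size at most `(h⌈m/d⌉ - h + 1)d` for a divisor `d` of `n` minimizing this
expression; consequently the minimum signed sumset size equals the minimum sumset size. -/
theorem stmt6 (n m h : ℕ) (hn : 0 < n) (hm : 1 ≤ m) (hmn : m ≤ n) (hh : 1 ≤ h) :
    (∃ R : Finset (ZMod n), (∀ x ∈ R, -x ∈ R) ∧ m ≤ R.card ∧
      ∃ d : ℕ, d ∣ n ∧
        (hsum h R).card ≤ (h * ((m + d - 1) / d) - h + 1) * d ∧
        ∀ d' : ℕ, d' ∣ n →
          (h * ((m + d - 1) / d) - h + 1) * d ≤ (h * ((m + d' - 1) / d') - h + 1) * d') ∧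
    (∀ ρ : ℕ,
      IsLeast {k : ℕ | ∃ A : Finset (ZMod n), A.card = m ∧ (hsum h A).card = k} ρ →
      IsLeast {k : ℕ | ∃ A : Finset (ZMod n), A.card = m ∧ (signedSumset h A).ncard = k} ρ) := by

  have : NeZero n := ⟨hn.ne'⟩
  refine ⟨exists_symmetric_card_hsum_le hn hm hmn hh, ?_⟩
  rintro ρ ⟨⟨A, hA, rfl⟩, hmin⟩
  have hle (B : Finset (ZMod n)) (hB : #B = m) : #(hsum h A) ≤ (signedSumset h B).ncard := by
    refine (hmin ⟨B, hB, rfl⟩).trans ?_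
    rw [← Set.ncard_coe_finset]
    exact Set.ncard_le_ncard (hsum_subset_signedSumset h B) (Set.toFinite _)
  refine ⟨?_, by rintro _ ⟨B, hB, rfl⟩; exact hle B hB⟩
  obtain ⟨R, hR, hmR, d, -, hcard, hopt⟩ := exists_symmetric_card_hsum_le hn hm hmn hh
  obtain ⟨B, hBR, hB⟩ := exists_subset_card_eq hmR
  refine ⟨B, hB, le_antisymm ?_ (hle B hB)⟩
  obtain ⟨d', hd', hA'⟩ :=
    exists_dvd_kneserBound_le_card_hsum (card_pos.1 (by omega : 0 < #A)) hh
  rw [ZMod.card] at hd'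
  rw [hA] at hA'
  refine le_trans ?_ ((hcard.trans (hopt d' hd')).trans hA')
  rw [← Set.ncard_coe_finset]
  exact Set.ncard_le_ncard (signedSumset_subset_hsum h hBR hR) (Set.toFinite _)
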